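/- There is C > 0 such that for all n ∈ ℕ, all t ∈ ℝ, and all v, w : ℤ → ℂ with ‖v‖_{H^{1/2}}, ‖w‖_{H^{1/2}} < ∞: ‖N₄(v)(t)‖_{H^{1/2}} ≤ C ‖v‖⁷_{H^{1/2}}, and ‖N₄(v)(t) − N₄(w)(t)‖_{H^{1/2}} ≤ C (‖v‖_{H^{1/2}} + ‖w‖_{H^{1/2}})⁶ ‖v − w‖_{H^{1/2}}, where N₄(v)(t)_k := ∑_{k₁+k₂+k₃=k, Φ(k̄)≠0, max(|k₁|,|k₂|,|k₃|)>n} (k/Φ(k̄)) e^{itΦ(k̄)} (N₂(v)(t))_{k₁} v_{k₂} v_{k₃}. -/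

import Mathlib

open scoped ENNReal

/-- Japanese bracket `⟨k⟩ = 1 + |k|`. -/
noncomputable def jb (k : ℤ) : ℝ := 1 + |(k : ℝ)|

/-- `‖f‖_{H^s} = (∑_k ⟨k⟩^{2s} |f k|²)^{1/2}`, valued in `[0,∞]`. -/
noncomputable def hnorm (s : ℝ) (f : ℤ → ℂ) : ℝ≥0∞ :=
  (∑' k : ℤ, ENNReal.ofReal (jb k ^ (2 * s) * ‖f k‖ ^ 2)) ^ (1 / 2 : ℝ)

/-- `Φ(k̄) = k³ − k₁³ − k₂³ − k₃³` with `k = k₁ + k₂ + k₃`. -/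
def Phi (k₁ k₂ k₃ : ℤ) : ℤ := (k₁ + k₂ + k₃) ^ 3 - k₁ ^ 3 - k₂ ^ 3 - k₃ ^ 3

/-- Cubic summand of `N₂(v)(t)_k`, parametrized by `(k₁, k₂)` with `k₃ = k - k₁ - k₂`. -/
noncomputable def N2term1 (v : ℤ → ℂ) (t : ℝ) (k : ℤ) (p : ℤ × ℤ) : ℂ :=
  if Phi p.1 p.2 (k - p.1 - p.2) ≠ 0 then
    -(((k : ℂ) * (p.1 : ℂ)) / (Complex.I * ((Phi p.1 p.2 (k - p.1 - p.2) : ℤ) : ℂ))) *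
      Complex.exp (Complex.I * (t : ℂ) * ((Phi p.1 p.2 (k - p.1 - p.2) : ℤ) : ℂ)) *
      (‖v p.1‖ : ℂ) ^ 2 * v p.1 * v p.2 * v (k - p.1 - p.2)
  else 0

/-- Quintic summand of `N₂(v)(t)_k`, parametrized by `(k₁, k₂, j₁, j₂)` with
`k₃ = k - k₁ - k₂` and `j₃ = k₁ - j₁ - j₂`. -/
noncomputable def N2term2 (v : ℤ → ℂ) (t : ℝ) (k : ℤ) (q : ℤ × ℤ × ℤ × ℤ) : ℂ :=
  if Phi q.1 q.2.1 (k - q.1 - q.2.1) ≠ 0 ∧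
      Phi q.2.2.1 q.2.2.2 (q.1 - q.2.2.1 - q.2.2.2) ≠ 0 then
    (1 / 3 : ℂ) *
      (((k : ℂ) * (q.1 : ℂ)) / (Complex.I * ((Phi q.1 q.2.1 (k - q.1 - q.2.1) : ℤ) : ℂ))) *
      Complex.exp (Complex.I * (t : ℂ) *
        (((Phi q.1 q.2.1 (k - q.1 - q.2.1) : ℤ) : ℂ) +
          ((Phi q.2.2.1 q.2.2.2 (q.1 - q.2.2.1 - q.2.2.2) : ℤ) : ℂ))) *
      v q.2.2.1 * v q.2.2.2 * v (q.1 - q.2.2.1 - q.2.2.2) * v q.2.1 * v (k - q.1 - q.2.1)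
  else 0

/-- `N₂(v)(t)_k`, arising from differentiation by parts. -/
noncomputable def N2 (v : ℤ → ℂ) (t : ℝ) (k : ℤ) : ℂ :=
  (∑' p : ℤ × ℤ, N2term1 v t k p) + ∑' q : ℤ × ℤ × ℤ × ℤ, N2term2 v t k q

/-- `N₄(v)(t)_k = ∑_{k₁+k₂+k₃=k, Φ(k̄)≠0, max(|kᵢ|)>n} (k/Φ(k̄)) e^{itΦ(k̄)} (N₂(v)(t))_{k₁} v_{k₂} v_{k₃}`. -/
noncomputable def N4 (n : ℕ) (v : ℤ → ℂ) (t : ℝ) (k : ℤ) : ℂ :=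
  ∑' p : ℤ × ℤ,
    if Phi p.1 p.2 (k - p.1 - p.2) ≠ 0 ∧
        (n : ℤ) < max (max |p.1| |p.2|) |k - p.1 - p.2| then
      ((k : ℂ) / ((Phi p.1 p.2 (k - p.1 - p.2) : ℤ) : ℂ)) *
        Complex.exp (Complex.I * (t : ℂ) * ((Phi p.1 p.2 (k - p.1 - p.2) : ℤ) : ℂ)) *
        N2 v t p.1 * v p.2 * v (k - p.1 - p.2)
    else 0

/-! ### Sums of extended nonnegative reals -/

theorem ENNReal.tsum_sq_le_tsum_mul_tsum {ι : Type*} {x y z : ι → ℝ≥0∞}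
    (h : ∀ i, z i ^ 2 ≤ x i * y i) : (∑' i, z i) ^ 2 ≤ (∑' i, x i) * ∑' i, y i := by
  have half_sq (a : ℝ≥0∞) : (a ^ (1 / 2 : ℝ)) ^ (2 : ℝ) = a := by
    rw [← ENNReal.rpow_mul]; norm_num
  have half_sq' (a : ℝ≥0∞) : (a ^ (1 / 2 : ℝ)) ^ 2 = a := by
    rw [← ENNReal.rpow_natCast]; exact_mod_cast half_sq a
  have hz (i : ι) : z i ≤ x i ^ (1 / 2 : ℝ) * y i ^ (1 / 2 : ℝ) := by
    rw [← ENNReal.pow_le_pow_left_iff (n := 2) two_ne_zero, mul_pow, half_sq', half_sq']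
    exact h i
  have key : ∑' i, z i ≤ (∑' i, x i) ^ (1 / 2 : ℝ) * (∑' i, y i) ^ (1 / 2 : ℝ) := by
    rw [ENNReal.tsum_eq_iSup_sum]
    refine iSup_le fun s => ?_
    calc ∑ i ∈ s, z i ≤ ∑ i ∈ s, x i ^ (1 / 2 : ℝ) * y i ^ (1 / 2 : ℝ) :=
          Finset.sum_le_sum fun i _ => hz i
      _ ≤ (∑ i ∈ s, x i) ^ (1 / 2 : ℝ) * (∑ i ∈ s, y i) ^ (1 / 2 : ℝ) := by
          have := ENNReal.inner_le_Lp_mul_Lq s (fun i => x i ^ (1 / 2 : ℝ))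
            (fun i => y i ^ (1 / 2 : ℝ)) Real.HolderConjugate.two_two
          simpa only [half_sq] using this
      _ ≤ _ := by gcongr <;> exact ENNReal.sum_le_tsum s
  calc (∑' i, z i) ^ 2 ≤ ((∑' i, x i) ^ (1 / 2 : ℝ) * (∑' i, y i) ^ (1 / 2 : ℝ)) ^ 2 := by gcongr
    _ = _ := by rw [mul_pow, half_sq', half_sq']

theorem ENNReal.mul_tsum_sq_le_tsum_mul_tsum {ι : Type*} {x y z : ι → ℝ≥0∞} {c : ℝ≥0∞}
    (h : ∀ i, c * z i ^ 2 ≤ x i * y i) : c * (∑' i, z i) ^ 2 ≤ (∑' i, x i) * ∑' i, y i := by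
  have hc : (c ^ (1 / 2 : ℝ)) ^ 2 = c := by
    rw [← ENNReal.rpow_natCast, ← ENNReal.rpow_mul]; norm_num
  have := ENNReal.tsum_sq_le_tsum_mul_tsum (x := x) (y := y)
    (z := fun i => c ^ (1 / 2 : ℝ) * z i) fun i => by rw [mul_pow, hc]; exact h i
  rwa [ENNReal.tsum_mul_left, mul_pow, hc] at this

theorem ENNReal.add_sq_le_two_mul (a b : ℝ≥0∞) : (a + b) ^ 2 ≤ 2 * (a ^ 2 + b ^ 2) := by
  have := ENNReal.rpow_add_le_mul_rpow_add_rpow a b (p := 2) (by norm_num)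
  norm_num at this
  exact this

theorem ENNReal.add_add_sq_le_three_mul (a b c : ℝ≥0∞) :
    (a + b + c) ^ 2 ≤ 3 * (a ^ 2 + b ^ 2 + c ^ 2) := by
  have := ENNReal.tsum_sq_le_tsum_mul_tsum (x := fun _ : Fin 3 => 1) (y := fun i => ![a, b, c] i ^ 2)
    (z := ![a, b, c]) (by simp)
  simpa [tsum_fintype, Fin.sum_univ_three] using this

theorem tsum_sub_left_int (k : ℤ) (f : ℤ → ℝ≥0∞) : ∑' x, f (k - x) = ∑' x, f x :=
  (Equiv.subLeft k).tsum_eq f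

theorem tsum_convolution_three (f g h : ℤ → ℝ≥0∞) :
    ∑' k : ℤ, ∑' p : ℤ × ℤ, f p.1 * g p.2 * h (k - p.1 - p.2) =
      (∑' x, f x) * (∑' x, g x) * ∑' x, h x := by
  have shift (p : ℤ × ℤ) : ∑' k : ℤ, h (k - p.1 - p.2) = ∑' x, h x := by
    simpa [sub_sub] using (Equiv.subRight (p.1 + p.2)).tsum_eq h
  rw [ENNReal.tsum_comm]
  simp_rw [ENNReal.tsum_mul_left, shift, ENNReal.tsum_mul_right, ENNReal.tsum_prod',
    ENNReal.tsum_mul_left, ENNReal.tsum_mul_right]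

/-! ### Weights -/

theorem one_le_jb (k : ℤ) : 1 ≤ jb k := by simp [jb]

theorem jb_pos (k : ℤ) : 0 < jb k := one_pos.trans_le (one_le_jb k)

theorem jb_add_le (x y : ℤ) : jb (x + y) ≤ jb x + |(y : ℝ)| := by
  have := abs_add_le (x : ℝ) y
  simp only [jb]; push_cast; linarith

/-- The summable weight `⟨k⟩^{-3/2}`. -/
noncomputable def decay (k : ℤ) : ℝ := 1 / (jb k * √(jb k))

theorem decay_pos (k : ℤ) : 0 < decay k := by
  have := jb_pos k
  unfold decay; positivity

theorem inv_jb_sq_le_decay (k : ℤ) : 1 / jb k ^ 2 ≤ decay k := by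
  have h1 := one_le_jb k
  have h0 := jb_pos k
  unfold decay
  rw [sq]
  gcongr
  exact Real.sqrt_le_iff.2 ⟨h0.le, by nlinarith⟩

theorem inv_abs_sq_le_decay {k : ℤ} (hk : k ≠ 0) : 1 / |(k : ℝ)| ^ 2 ≤ 4 * decay k := by
  have h1 : (1 : ℝ) ≤ |(k : ℝ)| := by exact_mod_cast Int.one_le_abs hk
  have h2 : 1 / |(k : ℝ)| ^ 2 ≤ 4 * (1 / jb k ^ 2) := by
    have := jb_pos k
    rw [mul_one_div, div_le_div_iff₀ (by positivity) (by positivity)]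
    unfold jb; nlinarith
  linarith [inv_jb_sq_le_decay k]

theorem summable_decay : Summable decay := by
  have h := Real.summable_abs_int_rpow (b := 3 / 2) (by norm_num)
  refine Summable.of_norm_bounded_eventually h ?_
  rw [Filter.eventually_cofinite]
  refine (Set.finite_singleton (0 : ℤ)).subset fun k hk => ?_
  by_contra hk0
  refine hk ?_
  have hpos : (0 : ℝ) < |(k : ℝ)| := by simpa using hk0
  have hj := jb_pos k
  rw [Real.norm_of_nonneg (decay_pos k).le, decay, Real.rpow_neg hpos.le, ← one_div]
  have : jb k * √(jb k) = jb k ^ (3 / 2 : ℝ) := by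
    rw [Real.sqrt_eq_rpow, ← Real.rpow_one_add' hj.le (by norm_num)]; norm_num
  rw [this]
  gcongr
  simp [jb]

/-- A weight for frequencies `(p₁, p₂, k - p₁ - p₂)` which is summable over `p`
uniformly in `k`. -/
noncomputable def pairDecay (k : ℤ) (p : ℤ × ℤ) : ℝ :=
  (decay p.1 + decay (k - p.1)) * (decay p.2 + decay (k - p.2)) +
    (decay p.2 + decay (k - p.2)) *
      (decay (k - p.1 - p.2) + decay (k - (k - p.1 - p.2))) +
    (decay p.1 + decay (k - p.1)) *
      (decay (k - p.1 - p.2) + decay (k - (k - p.1 - p.2)))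

theorem tsum_pairDecay_le (k : ℤ) :
    ∑' p, ENNReal.ofReal (pairDecay k p) ≤ 12 * (∑' x, ENNReal.ofReal (decay x)) ^ 2 := by
  set S := ∑' x, ENNReal.ofReal (decay x) with hS
  set X : ℤ → ℝ≥0∞ := fun x => ENNReal.ofReal (decay x) + ENNReal.ofReal (decay (k - x)) with hX
  have hXsum : ∑' x, X x = 2 * S := by
    rw [ENNReal.tsum_add, tsum_sub_left_int k fun x => ENNReal.ofReal (decay x), two_mul]
  have hof (x : ℤ) : ENNReal.ofReal (decay x + decay (k - x)) = X x :=
    ENNReal.ofReal_add (decay_pos _).le (decay_pos _).le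
  have hnn (x : ℤ) : 0 ≤ decay x + decay (k - x) := add_nonneg (decay_pos _).le (decay_pos _).le
  have hpair (p : ℤ × ℤ) : ENNReal.ofReal (pairDecay k p) =
      X p.1 * X p.2 + X p.2 * X (k - p.1 - p.2) + X p.1 * X (k - p.1 - p.2) := by
    have h1 := hnn p.1
    have h2 := hnn p.2
    have h3 := hnn (k - p.1 - p.2)
    rw [pairDecay, ENNReal.ofReal_add (by positivity) (by positivity),
      ENNReal.ofReal_add (by positivity) (by positivity), ENNReal.ofReal_mul h1,
      ENNReal.ofReal_mul h2, ENNReal.ofReal_mul h1, hof, hof, hof]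
  have h3 : ∑' y, ∑' x, X y * X (k - x - y) = 2 * S * (2 * S) := by
    simp_rw [ENNReal.tsum_mul_left, sub_right_comm k, tsum_sub_left_int, ENNReal.tsum_mul_right,
      hXsum]
  simp_rw [hpair, ENNReal.tsum_add, ENNReal.tsum_prod']
  rw [ENNReal.tsum_comm (f := fun x y => X y * X (k - x - y)), h3]
  simp_rw [ENNReal.tsum_mul_left, tsum_sub_left_int, ENNReal.tsum_mul_right, hXsum]
  apply le_of_eq; ring

/-- The constant in the trilinear estimates. -/
noncomputable def triConst : ℝ≥0∞ := 1000 * (12 * (∑' x, ENNReal.ofReal (decay x)) ^ 2)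

theorem triConst_ne_top : triConst ≠ ⊤ := by
  have : ∑' x, ENNReal.ofReal (decay x) ≠ ⊤ := by
    rw [← ENNReal.ofReal_tsum_of_nonneg (fun x => (decay_pos x).le) summable_decay]
    exact ENNReal.ofReal_ne_top
  unfold triConst
  finiteness

theorem trilinear_sq_le {M : ℤ → ℤ × ℤ → ℝ≥0∞} {c α β γ : ℤ → ℝ≥0∞}
    (hM : ∀ k p, c k * M k p ^ 2 ≤
      1000 * ENNReal.ofReal (pairDecay k p) * (α p.1 * β p.2 * γ (k - p.1 - p.2)))
    (f g h : ℤ → ℝ≥0∞) :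
    ∑' k, c k * (∑' p : ℤ × ℤ, M k p * f p.1 * g p.2 * h (k - p.1 - p.2)) ^ 2 ≤
      triConst * ((∑' x, α x * f x ^ 2) * (∑' x, β x * g x ^ 2) * ∑' x, γ x * h x ^ 2) := by
  rw [← tsum_convolution_three, ← ENNReal.tsum_mul_left]
  refine ENNReal.tsum_le_tsum fun k => ?_
  refine (ENNReal.mul_tsum_sq_le_tsum_mul_tsum
    (x := fun p => 1000 * ENNReal.ofReal (pairDecay k p))
    (y := fun p => α p.1 * f p.1 ^ 2 * (β p.2 * g p.2 ^ 2) *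
      (γ (k - p.1 - p.2) * h (k - p.1 - p.2) ^ 2)) fun p => ?_).trans ?_
  · calc c k * (M k p * f p.1 * g p.2 * h (k - p.1 - p.2)) ^ 2
        = c k * M k p ^ 2 * (f p.1 ^ 2 * g p.2 ^ 2 * h (k - p.1 - p.2) ^ 2) := by ring
      _ ≤ 1000 * ENNReal.ofReal (pairDecay k p) * (α p.1 * β p.2 * γ (k - p.1 - p.2)) *
          (f p.1 ^ 2 * g p.2 ^ 2 * h (k - p.1 - p.2) ^ 2) := by gcongr ?_ * _; exact hM k p
      _ = _ := by ring
  · rw [ENNReal.tsum_mul_left, triConst]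
    gcongr
    exact tsum_pairDecay_le k

/-! ### Multiplier bounds -/

theorem Phi_eq_mul (k : ℤ) (p : ℤ × ℤ) : Phi p.1 p.2 (k - p.1 - p.2) =
    3 * ((k - p.1) * (k - p.2) * (k - (k - p.1 - p.2))) := by
  unfold Phi; ring

theorem cube_mul_le_of_resonance {a b c x y z : ℝ} (hb : 1 ≤ b) (hc : 1 ≤ c)
    (hx : 1 ≤ x) (hy : 1 ≤ y) (hz : 1 ≤ z) (hzx : z ≤ x + b) (hzy : z ≤ y + c)
    (hzs : z ≤ a + b + c) :
    z ^ 3 * (x * y) ≤ 8 * ((x * y) ^ 2 * (a ^ 2 + b ^ 2 + c ^ 2) +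
      b ^ 2 * c ^ 2 * (x ^ 2 + y ^ 2)) := by
  have hQ : z ^ 2 ≤ 3 * (a ^ 2 + b ^ 2 + c ^ 2) := by
    nlinarith [sq_nonneg (a - b), sq_nonneg (b - c), sq_nonneg (a - c)]
  have h1 : z ^ 2 * x * y ≤ 3 * (a ^ 2 + b ^ 2 + c ^ 2) * x * y ^ 2 := by
    have : y ≤ y ^ 2 := by nlinarith
    gcongr
  have h2 : z * b * y ^ 2 ≤ 2 * (x * y ^ 2 * b ^ 2) := by
    have : z * b ≤ 2 * (x * b ^ 2) := by
      nlinarith [mul_nonneg (sub_nonneg.2 hx) (sq_nonneg b),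
        mul_nonneg (by positivity : 0 ≤ x * b) (sub_nonneg.2 hb)]
    nlinarith [mul_le_mul_of_nonneg_right this (sq_nonneg y)]
  have h3 : x * y * (b * c) ≤ x * y ^ 2 * (b ^ 2 + c ^ 2) := by
    have : y ≤ y ^ 2 := by nlinarith
    have : b * c ≤ b ^ 2 + c ^ 2 := by nlinarith [sq_nonneg (b - c), sq_nonneg b, sq_nonneg c]
    gcongr
  have h4 : b ^ 2 * c * y ≤ x * (b ^ 2 * c ^ 2 + b ^ 2 * y ^ 2) := by
    have : c * y ≤ c ^ 2 + y ^ 2 := by nlinarith [sq_nonneg (c - y), sq_nonneg c, sq_nonneg y]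
    calc b ^ 2 * c * y = 1 * (b ^ 2 * (c * y)) := by ring
      _ ≤ x * (b ^ 2 * (c ^ 2 + y ^ 2)) := by gcongr
      _ = _ := by ring
  have h5 : z ^ 3 * y ≤ z ^ 2 * x * y + z * b * y ^ 2 + x * y * (b * c) + b ^ 2 * c * y := by
    calc z ^ 3 * y = z ^ 2 * y * z := by ring
      _ ≤ z ^ 2 * y * (x + b) := by gcongr
      _ = z ^ 2 * x * y + z * b * y * z := by ring
      _ ≤ z ^ 2 * x * y + z * b * y * (y + c) := by gcongr
      _ = z ^ 2 * x * y + z * b * y ^ 2 + b * c * y * z := by ring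
      _ ≤ z ^ 2 * x * y + z * b * y ^ 2 + b * c * y * (x + b) := by gcongr
      _ = _ := by ring
  have h6 : z ^ 3 * y ≤ 8 * (x * y ^ 2 * (a ^ 2 + b ^ 2 + c ^ 2) + b ^ 2 * c ^ 2 * x) := by
    have ha : 0 ≤ x * y ^ 2 * a ^ 2 := by positivity
    have hb : 0 ≤ x * y ^ 2 * b ^ 2 := by positivity
    have hc : 0 ≤ x * y ^ 2 * c ^ 2 := by positivity
    have hd : 0 ≤ b ^ 2 * c ^ 2 * x := by positivity
    linarith
  have h7 : 0 ≤ b ^ 2 * c ^ 2 * y ^ 2 := by positivity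
  nlinarith [mul_le_mul_of_nonneg_right h6 (zero_le_one.trans hx)]

theorem sq_mul_le_of_resonance {a b c x y : ℝ} (hb : 1 ≤ b) (hc : 1 ≤ c)
    (hx : 1 ≤ x) (hy : 1 ≤ y) (hxs : x ≤ a + b + c) (hys : y ≤ a + b + c) :
    (b * c + x * y) ^ 2 * (x * y) ≤
      8 * ((x * y) ^ 2 * (a ^ 2 + b ^ 2 + c ^ 2) + b ^ 2 * c ^ 2 * (x ^ 2 + y ^ 2)) := by
  have hxy : x * y ≤ 3 * (a ^ 2 + b ^ 2 + c ^ 2) := by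
    have : x * y ≤ (a + b + c) * (a + b + c) := by gcongr; linarith
    nlinarith [sq_nonneg (a - b), sq_nonneg (b - c), sq_nonneg (a - c)]
  have h1 : (b * c + x * y) ^ 2 ≤ 2 * ((b * c) ^ 2 + (x * y) ^ 2) := by
    nlinarith [sq_nonneg (b * c - x * y)]
  have h2 : 0 ≤ (x * y) ^ 2 * (a ^ 2 + b ^ 2 + c ^ 2) := by positivity
  have h3 : 0 ≤ (b * c) ^ 2 * (x ^ 2 + y ^ 2) := by positivity
  have h4 : (b * c) ^ 2 * (2 * (x * y)) ≤ (b * c) ^ 2 * (x ^ 2 + y ^ 2) := by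
    gcongr; nlinarith [sq_nonneg (x - y)]
  calc (b * c + x * y) ^ 2 * (x * y) ≤ 2 * ((b * c) ^ 2 + (x * y) ^ 2) * (x * y) := by gcongr
    _ = (b * c) ^ 2 * (2 * (x * y)) + 2 * ((x * y) ^ 2 * (x * y)) := by ring
    _ ≤ (b * c) ^ 2 * (x ^ 2 + y ^ 2) +
        2 * ((x * y) ^ 2 * (3 * (a ^ 2 + b ^ 2 + c ^ 2))) := by gcongr
    _ ≤ _ := by nlinarith

theorem sum_inv_le_pairDecay {k : ℤ} {p : ℤ × ℤ} (hA : k - p.1 ≠ 0) (hB : k - p.2 ≠ 0)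
    (hC : k - (k - p.1 - p.2) ≠ 0) :
    1 / |((k - p.1 : ℤ) : ℝ)| ^ 2 * (1 / |((k - p.2 : ℤ) : ℝ)| ^ 2) +
      1 / |((k - p.2 : ℤ) : ℝ)| ^ 2 * (1 / |((k - (k - p.1 - p.2) : ℤ) : ℝ)| ^ 2) +
      1 / |((k - p.1 : ℤ) : ℝ)| ^ 2 * (1 / |((k - (k - p.1 - p.2) : ℤ) : ℝ)| ^ 2) +
      1 / |((k - p.1 : ℤ) : ℝ)| ^ 2 * (1 / jb p.2 ^ 2) +
      1 / |((k - p.1 : ℤ) : ℝ)| ^ 2 * (1 / jb (k - p.1 - p.2) ^ 2) ≤ 16 * pairDecay k p := by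
  have hA' := inv_abs_sq_le_decay hA
  have hB' := inv_abs_sq_le_decay hB
  have hC' := inv_abs_sq_le_decay hC
  have h2 := inv_jb_sq_le_decay p.2
  have h3 := inv_jb_sq_le_decay (k - p.1 - p.2)
  have d1 := decay_pos p.1
  have d2 := decay_pos p.2
  have d3 := decay_pos (k - p.1 - p.2)
  have dA := decay_pos (k - p.1)
  have dB := decay_pos (k - p.2)
  have dC := decay_pos (k - (k - p.1 - p.2))
  have mA := mul_le_mul hA' hB' (by positivity) (by positivity)
  have mB := mul_le_mul hB' hC' (by positivity) (by positivity)
  have mC := mul_le_mul hA' hC' (by positivity) (by positivity)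
  have mD := mul_le_mul hA' h2 (by positivity) (by positivity)
  have mE := mul_le_mul hA' h3 (by positivity) (by positivity)
  refine (add_le_add (add_le_add (add_le_add (add_le_add mA mB) mC) mD) mE).trans ?_
  unfold pairDecay
  generalize decay p.1 = w1 at *
  generalize decay p.2 = w2 at *
  generalize decay (k - p.1 - p.2) = w3 at *
  generalize decay (k - p.1) = wA at *
  generalize decay (k - p.2) = wB at *
  generalize decay (k - (k - p.1 - p.2)) = wC at *
  rw [← sub_nonneg]
  ring_nf
  positivity

theorem div_Phi_sq_le {k : ℤ} {p : ℤ × ℤ} (hΦ : Phi p.1 p.2 (k - p.1 - p.2) ≠ 0) {T : ℝ}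
    (hT : T * (jb p.2 * jb (k - p.1 - p.2)) ≤
      8 * ((jb p.2 * jb (k - p.1 - p.2)) ^ 2 *
          (|((k - p.1 : ℤ) : ℝ)| ^ 2 + |((k - p.2 : ℤ) : ℝ)| ^ 2 +
            |((k - (k - p.1 - p.2) : ℤ) : ℝ)| ^ 2) +
        |((k - p.2 : ℤ) : ℝ)| ^ 2 * |((k - (k - p.1 - p.2) : ℤ) : ℝ)| ^ 2 *
          (jb p.2 ^ 2 + jb (k - p.1 - p.2) ^ 2))) :
    T / (Phi p.1 p.2 (k - p.1 - p.2) : ℝ) ^ 2 ≤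
      1000 * pairDecay k p * (jb p.2 * jb (k - p.1 - p.2)) := by
  have hprod := hΦ
  rw [Phi_eq_mul] at hprod
  have hA : k - p.1 ≠ 0 := by rintro h; simp [h] at hprod
  have hB : k - p.2 ≠ 0 := by rintro h; simp [h] at hprod
  have hC : k - (k - p.1 - p.2) ≠ 0 := by rintro h; rw [h] at hprod; simp at hprod
  have hY := sum_inv_le_pairDecay hA hB hC
  have hsq : (Phi p.1 p.2 (k - p.1 - p.2) : ℝ) ^ 2 = 9 * (|((k - p.1 : ℤ) : ℝ)| ^ 2 *
      |((k - p.2 : ℤ) : ℝ)| ^ 2 * |((k - (k - p.1 - p.2) : ℤ) : ℝ)| ^ 2) := by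
    rw [Phi_eq_mul, sq_abs, sq_abs, sq_abs]; push_cast; ring
  rw [hsq]
  have ha : 0 < |((k - p.1 : ℤ) : ℝ)| := by simpa using mod_cast hA
  have hb : 0 < |((k - p.2 : ℤ) : ℝ)| := by rw [abs_pos]; exact_mod_cast hB
  have hc : 0 < |((k - (k - p.1 - p.2) : ℤ) : ℝ)| := by rw [abs_pos]; exact_mod_cast hC
  have hx := jb_pos p.2
  have hy := jb_pos (k - p.1 - p.2)
  have hn : 0 ≤ pairDecay k p := by
    refine nonneg_of_mul_nonneg_right (le_trans ?_ hY) (by norm_num); positivity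
  generalize |((k - p.1 : ℤ) : ℝ)| = a at *
  generalize |((k - p.2 : ℤ) : ℝ)| = b at *
  generalize |((k - (k - p.1 - p.2) : ℤ) : ℝ)| = c at *
  generalize jb p.2 = x at *
  generalize jb (k - p.1 - p.2) = y at *
  generalize pairDecay k p = n at *
  rw [div_le_iff₀ (by positivity)]
  refine le_of_mul_le_mul_right (hT.trans ?_) (mul_pos hx hy)
  calc _ = 8 * (1 / a ^ 2 * (1 / b ^ 2) + 1 / b ^ 2 * (1 / c ^ 2) + 1 / a ^ 2 * (1 / c ^ 2) +
        1 / a ^ 2 * (1 / x ^ 2) + 1 / a ^ 2 * (1 / y ^ 2)) *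
          ((x * y) ^ 2 * (a ^ 2 * b ^ 2 * c ^ 2)) := by field_simp; ring
    _ ≤ 8 * (16 * n) * ((x * y) ^ 2 * (a ^ 2 * b ^ 2 * c ^ 2)) := by gcongr
    _ ≤ 9000 * n * ((x * y) ^ 2 * (a ^ 2 * b ^ 2 * c ^ 2)) := by
        gcongr ?_ * _; linarith
    _ = _ := by ring

theorem abs_two_mul_le {x a b c : ℝ} (h : 2 * x = a + b + c ∨ 2 * x = a - b + c ∨
    2 * x = a + b - c) (habc : 2 ≤ |a| + |b| + |c|) : 1 + |x| ≤ |a| + |b| + |c| := by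
  have : |2 * x| ≤ |a| + |b| + |c| := by
    rcases h with h | h | h <;> rw [h, abs_le] <;> constructor <;>
    linarith [le_abs_self a, le_abs_self b, le_abs_self c, neg_abs_le a, neg_abs_le b, neg_abs_le c]
  rw [abs_mul, abs_two] at this
  linarith

/-- The multiplier `|k| / |Φ|`. -/
noncomputable def multN4 (k : ℤ) (p : ℤ × ℤ) : ℝ≥0∞ :=
  if Phi p.1 p.2 (k - p.1 - p.2) ≠ 0 then
    ENNReal.ofReal (|(k : ℝ)| / |(Phi p.1 p.2 (k - p.1 - p.2) : ℝ)|) else 0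

/-- The multiplier `|k k₁| / |Φ|`. -/
noncomputable def multN2 (k : ℤ) (p : ℤ × ℤ) : ℝ≥0∞ :=
  if Phi p.1 p.2 (k - p.1 - p.2) ≠ 0 then
    ENNReal.ofReal (|(k : ℝ) * p.1| / |(Phi p.1 p.2 (k - p.1 - p.2) : ℝ)|) else 0

theorem one_le_abs_of_Phi_ne_zero {k : ℤ} {p : ℤ × ℤ} (hΦ : Phi p.1 p.2 (k - p.1 - p.2) ≠ 0) :
    1 ≤ |((k - p.1 : ℤ) : ℝ)| ∧ 1 ≤ |((k - p.2 : ℤ) : ℝ)| ∧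
      1 ≤ |((k - (k - p.1 - p.2) : ℤ) : ℝ)| := by
  rw [Phi_eq_mul] at hΦ
  have hA : k - p.1 ≠ 0 := by rintro h; simp [h] at hΦ
  have hB : k - p.2 ≠ 0 := by rintro h; simp [h] at hΦ
  have hC : k - (k - p.1 - p.2) ≠ 0 := by rintro h; rw [h] at hΦ; simp at hΦ
  exact ⟨mod_cast Int.one_le_abs hA, mod_cast Int.one_le_abs hB, mod_cast Int.one_le_abs hC⟩

theorem multN4_sq_le (k : ℤ) (p : ℤ × ℤ) :
    ENNReal.ofReal (jb k) * multN4 k p ^ 2 ≤ 1000 * ENNReal.ofReal (pairDecay k p) *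
      (1 * ENNReal.ofReal (jb p.2) * ENNReal.ofReal (jb (k - p.1 - p.2))) := by
  unfold multN4
  split_ifs with hΦ
  swap; · simp
  obtain ⟨ha, hb, hc⟩ := one_le_abs_of_Phi_ne_zero hΦ
  have hj := jb_pos k
  rw [one_mul, ← ENNReal.ofReal_mul (jb_pos _).le, ← ENNReal.ofReal_pow (by positivity),
    ← ENNReal.ofReal_mul (jb_pos _).le, show (1000 : ℝ≥0∞) = ENNReal.ofReal 1000 by simp,
    ← ENNReal.ofReal_mul (by norm_num),
    ← ENNReal.ofReal_mul' (mul_pos (jb_pos _) (jb_pos _)).le]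
  refine ENNReal.ofReal_le_ofReal ?_
  refine le_trans ?_ (div_Phi_sq_le hΦ (T := jb k ^ 3) ?_)
  · rw [div_pow, sq_abs (Phi _ _ _ : ℝ), mul_div_assoc', pow_succ' (jb k) 2]
    gcongr
    simp [jb]
  · refine cube_mul_le_of_resonance hb hc (one_le_jb _) (one_le_jb _) (one_le_jb _) ?_ ?_ ?_
    · simpa using jb_add_le p.2 (k - p.2)
    · simpa using jb_add_le (k - p.1 - p.2) (k - (k - p.1 - p.2))
    · exact abs_two_mul_le (.inl (by push_cast; ring)) (by linarith)

theorem multN2_sq_le (k : ℤ) (p : ℤ × ℤ) :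
    1 * multN2 k p ^ 2 ≤ 1000 * ENNReal.ofReal (pairDecay k p) *
      (1 * ENNReal.ofReal (jb p.2) * ENNReal.ofReal (jb (k - p.1 - p.2))) := by
  unfold multN2
  split_ifs with hΦ
  swap; · simp
  obtain ⟨ha, hb, hc⟩ := one_le_abs_of_Phi_ne_zero hΦ
  rw [one_mul, one_mul, ← ENNReal.ofReal_mul (jb_pos _).le, ← ENNReal.ofReal_pow (by positivity),
    show (1000 : ℝ≥0∞) = ENNReal.ofReal 1000 by simp,
    ← ENNReal.ofReal_mul (by norm_num),
    ← ENNReal.ofReal_mul' (mul_pos (jb_pos _) (jb_pos _)).le]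
  refine ENNReal.ofReal_le_ofReal ?_
  refine le_trans ?_ (div_Phi_sq_le hΦ (T := (|((k - p.2 : ℤ) : ℝ)| *
    |((k - (k - p.1 - p.2) : ℤ) : ℝ)| + jb p.2 * jb (k - p.1 - p.2)) ^ 2) ?_)
  · rw [div_pow, sq_abs (Phi _ _ _ : ℝ)]
    gcongr
    have : (k : ℝ) * p.1 = ((k - p.2 : ℤ) : ℝ) * ((k - (k - p.1 - p.2) : ℤ) : ℝ) -
      (p.2 : ℝ) * ((k - p.1 - p.2 : ℤ) : ℝ) := by push_cast; ring
    rw [this, ← abs_mul]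
    refine (abs_sub _ _).trans ?_
    rw [abs_mul (p.2 : ℝ)]
    have h2 : |(p.2 : ℝ)| ≤ jb p.2 := by simp [jb]
    have h3 : |((k - p.1 - p.2 : ℤ) : ℝ)| ≤ jb (k - p.1 - p.2) := by simp [jb]
    have := jb_pos p.2
    gcongr
  · refine sq_mul_le_of_resonance hb hc (one_le_jb _) (one_le_jb _) ?_ ?_
    · exact abs_two_mul_le (.inr (.inl (by push_cast; ring))) (by linarith)
    · exact abs_two_mul_le (.inr (.inr (by push_cast; ring))) (by linarith)

theorem one_le_pairDecay_mul (k : ℤ) (p : ℤ × ℤ) :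
    1 * (1 : ℝ≥0∞) ^ 2 ≤ 1000 * ENNReal.ofReal (pairDecay k p) *
      (ENNReal.ofReal (jb p.1) * ENNReal.ofReal (jb p.2) *
        ENNReal.ofReal (jb (k - p.1 - p.2))) := by
  have hx := jb_pos p.1
  have hy := jb_pos p.2
  have hz := jb_pos (k - p.1 - p.2)
  rw [one_pow, one_mul, ← ENNReal.ofReal_mul hx.le, ← ENNReal.ofReal_mul (by positivity),
    show (1000 : ℝ≥0∞) = ENNReal.ofReal 1000 by simp, ← ENNReal.ofReal_mul (by norm_num),
    ← ENNReal.ofReal_mul' (by positivity), ENNReal.one_le_ofReal]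
  have hle : decay p.1 * decay p.2 + decay p.2 * decay (k - p.1 - p.2) +
      decay p.1 * decay (k - p.1 - p.2) ≤ pairDecay k p := by
    have hadd (x y : ℤ) : decay x ≤ decay x + decay y := le_add_of_nonneg_right (decay_pos _).le
    have hnn (x : ℤ) : 0 ≤ decay x := (decay_pos x).le
    unfold pairDecay
    gcongr <;> first | exact hadd _ _ | exact hnn _ | exact add_nonneg (hnn _) (hnn _)
  have key : 1 ≤ (decay p.1 * decay p.2 + decay p.2 * decay (k - p.1 - p.2) +
      decay p.1 * decay (k - p.1 - p.2)) * (jb p.1 * jb p.2 * jb (k - p.1 - p.2)) := by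
    unfold decay
    set x := √(jb p.1) with hxd
    set y := √(jb p.2) with hyd
    set z := √(jb (k - p.1 - p.2)) with hzd
    have hx' : 0 < x := Real.sqrt_pos.2 hx
    have hy' : 0 < y := Real.sqrt_pos.2 hy
    have hz' : 0 < z := Real.sqrt_pos.2 hz
    rw [← Real.sq_sqrt hx.le, ← Real.sq_sqrt hy.le, ← Real.sq_sqrt hz.le, ← hxd, ← hyd, ← hzd]
    have : (1 / (x ^ 2 * x) * (1 / (y ^ 2 * y)) + 1 / (y ^ 2 * y) * (1 / (z ^ 2 * z)) +
        1 / (x ^ 2 * x) * (1 / (z ^ 2 * z))) * (x ^ 2 * y ^ 2 * z ^ 2) =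
        (x ^ 3 + y ^ 3 + z ^ 3) / (x * y * z) := by field_simp; ring
    rw [this, one_le_div (by positivity)]
    nlinarith [mul_nonneg (by positivity : 0 ≤ x + y + z)
      (by positivity : 0 ≤ (x - y) ^ 2 + (y - z) ^ 2 + (z - x) ^ 2),
      (by positivity : 0 ≤ x * y * z)]
  have hxyz : 0 ≤ jb p.1 * jb p.2 * jb (k - p.1 - p.2) := by positivity
  nlinarith [mul_le_mul_of_nonneg_right hle hxyz]

/-! ### Pairs of complex numbers with a common majorant -/

/-- `x` and `y` are bounded by `A`, and their difference by `ε * A`. -/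
structure RelClose (ε A : ℝ≥0∞) (x y : ℂ) : Prop where
  left : ‖x‖ₑ ≤ A
  right : ‖y‖ₑ ≤ A
  sub : ‖x - y‖ₑ ≤ ε * A

namespace RelClose

variable {ε δ A B : ℝ≥0∞} {x y x' y' : ℂ}

theorem refl (h : ‖x‖ₑ ≤ A) : RelClose ε A x x := ⟨h, h, by simp⟩

theorem mono (h : RelClose ε A x y) (hε : ε ≤ δ) (hA : A ≤ B) : RelClose δ B x y :=
  ⟨h.left.trans hA, h.right.trans hA, h.sub.trans (by gcongr)⟩

theorem mul (h : RelClose ε A x y) (h' : RelClose δ B x' y') :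
    RelClose (ε + δ) (A * B) (x * x') (y * y') where
  left := by rw [enorm_mul]; exact mul_le_mul' h.left h'.left
  right := by rw [enorm_mul]; exact mul_le_mul' h.right h'.right
  sub := by
    calc ‖x * x' - y * y'‖ₑ = ‖(x - y) * x' + y * (x' - y')‖ₑ := by ring_nf
      _ ≤ ‖x - y‖ₑ * ‖x'‖ₑ + ‖y‖ₑ * ‖x' - y'‖ₑ := by
          simpa only [enorm_mul] using enorm_add_le ((x - y) * x') (y * (x' - y'))
      _ ≤ ε * A * B + A * (δ * B) :=
          add_le_add (mul_le_mul' h.sub h'.left) (mul_le_mul' h.right h'.sub)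
      _ = _ := by ring

theorem const_mul {c : ℂ} (hc : ‖c‖ₑ ≤ B) (h : RelClose ε A x y) :
    RelClose ε (B * A) (c * x) (c * y) := by
  simpa using (refl (ε := 0) hc).mul h

theorem add (h : RelClose ε A x y) (h' : RelClose ε B x' y') :
    RelClose ε (A + B) (x + x') (y + y') where
  left := (enorm_add_le _ _).trans (add_le_add h.left h'.left)
  right := (enorm_add_le _ _).trans (add_le_add h.right h'.right)
  sub := by
    rw [add_sub_add_comm, mul_add]
    exact (enorm_add_le _ _).trans (add_le_add h.sub h'.sub)

theorem coe_norm (h : RelClose ε A x y) : RelClose ε A (‖x‖ : ℂ) (‖y‖ : ℂ) where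
  left := by simpa only [← ofReal_norm, Complex.norm_real, norm_norm] using h.left
  right := by simpa only [← ofReal_norm, Complex.norm_real, norm_norm] using h.right
  sub := by
    refine le_trans ?_ h.sub
    rw [← Complex.ofReal_sub, ← ofReal_norm, ← ofReal_norm, Complex.norm_real]
    exact ENNReal.ofReal_le_ofReal (abs_norm_sub_norm_le x y)

theorem tsum {ι : Type*} {a b : ι → ℂ} {A : ι → ℝ≥0∞} (hε : ε ≠ 0)
    (h : ∀ i, RelClose ε (A i) (a i) (b i)) :
    RelClose ε (∑' i, A i) (∑' i, a i) (∑' i, b i) where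
  left := enorm_tsum_le_tsum_enorm.trans (ENNReal.tsum_le_tsum fun i => (h i).left)
  right := enorm_tsum_le_tsum_enorm.trans (ENNReal.tsum_le_tsum fun i => (h i).right)
  sub := by
    by_cases hA : ∑' i, A i = ⊤
    · rw [hA, ENNReal.mul_top hε]; exact le_top
    have summable_of_le {c : ι → ℂ} (hc : ∀ i, ‖c i‖ₑ ≤ A i) : Summable c := by
      refine Summable.of_norm_bounded (ENNReal.summable_toReal hA) fun i => ?_
      rw [← toReal_enorm]
      exact ENNReal.toReal_mono (ENNReal.ne_top_of_tsum_ne_top hA i) (hc i)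
    rw [← (summable_of_le fun i => (h i).left).tsum_sub (summable_of_le fun i => (h i).right),
      ← ENNReal.tsum_mul_left]
    exact enorm_tsum_le_tsum_enorm.trans (ENNReal.tsum_le_tsum fun i => (h i).sub)

end RelClose

/-! ### Majorants of the nonlinear expressions -/

/-- The trilinear convolution operator with multiplier `M`. -/
noncomputable def trilin (M : ℤ → ℤ × ℤ → ℝ≥0∞) (f g h : ℤ → ℝ≥0∞) (k : ℤ) : ℝ≥0∞ :=
  ∑' p : ℤ × ℤ, M k p * f p.1 * g p.2 * h (k - p.1 - p.2)

/-- Majorant of `N2`. -/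
noncomputable def majN2 (g : ℤ → ℝ≥0∞) : ℤ → ℝ≥0∞ :=
  trilin multN2 (fun x => g x ^ 3 + trilin 1 g g g x) g g

/-- Majorant of `N4`. -/
noncomputable def majN4 (g : ℤ → ℝ≥0∞) : ℤ → ℝ≥0∞ := trilin multN4 (majN2 g) g g

section Majorants

variable {ε : ℝ≥0∞} {g : ℤ → ℝ≥0∞} {v w : ℤ → ℂ}

theorem enorm_phase (t x : ℝ) : ‖Complex.exp (Complex.I * (t : ℂ) * (x : ℂ))‖ₑ = 1 := by
  rw [show Complex.I * (t : ℂ) * (x : ℂ) = ((t * x : ℝ) : ℂ) * Complex.I by push_cast; ring,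
    ← ofReal_norm, Complex.norm_exp_ofReal_mul_I, ENNReal.ofReal_one]

theorem RelClose.N2term1 (h : ∀ k, RelClose ε (g k) (v k) (w k)) (t : ℝ) (k : ℤ) (p : ℤ × ℤ) :
    RelClose (5 * ε) (multN2 k p * g p.1 ^ 3 * g p.2 * g (k - p.1 - p.2))
      (N2term1 v t k p) (N2term1 w t k p) := by
  unfold _root_.N2term1
  split_ifs with hΦ
  swap; · exact .refl (by simp)
  have hc : ‖-(((k : ℂ) * (p.1 : ℂ)) / (Complex.I * ((Phi p.1 p.2 (k - p.1 - p.2) : ℤ) : ℂ))) *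
      Complex.exp (Complex.I * (t : ℂ) * ((Phi p.1 p.2 (k - p.1 - p.2) : ℤ) : ℂ))‖ₑ ≤
      multN2 k p := by
    have := enorm_phase t (Phi p.1 p.2 (k - p.1 - p.2) : ℤ)
    rw [enorm_mul, ← Complex.ofReal_intCast (Phi _ _ _), this, multN2, if_pos hΦ, mul_one,
      ← ofReal_norm]
    refine ENNReal.ofReal_le_ofReal (le_of_eq ?_)
    simp
  have hn := (h p.1).coe_norm
  have := ((((RelClose.const_mul hc (hn.mul hn)).mul (h p.1)).mul (h p.2)).mul
    (h (k - p.1 - p.2)))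
  simp only [sq]
  refine this.mono (le_of_eq ?_) (le_of_eq ?_) <;> ring

theorem RelClose.N2term2 (h : ∀ k, RelClose ε (g k) (v k) (w k)) (t : ℝ) (k : ℤ)
    (q : ℤ × ℤ × ℤ × ℤ) :
    RelClose (5 * ε) (multN2 k (q.1, q.2.1) *
      (g q.2.2.1 * g q.2.2.2 * g (q.1 - q.2.2.1 - q.2.2.2)) * g q.2.1 * g (k - q.1 - q.2.1))
      (N2term2 v t k q) (N2term2 w t k q) := by
  unfold _root_.N2term2
  split_ifs with hΦ
  swap; · exact .refl (by simp)
  have hc : ‖(1 / 3 : ℂ) *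
      (((k : ℂ) * (q.1 : ℂ)) / (Complex.I * ((Phi q.1 q.2.1 (k - q.1 - q.2.1) : ℤ) : ℂ))) *
      Complex.exp (Complex.I * (t : ℂ) *
        (((Phi q.1 q.2.1 (k - q.1 - q.2.1) : ℤ) : ℂ) +
          ((Phi q.2.2.1 q.2.2.2 (q.1 - q.2.2.1 - q.2.2.2) : ℤ) : ℂ)))‖ₑ ≤
      multN2 k (q.1, q.2.1) := by
    have := enorm_phase t ((Phi q.1 q.2.1 (k - q.1 - q.2.1) : ℤ) +
      (Phi q.2.2.1 q.2.2.2 (q.1 - q.2.2.1 - q.2.2.2) : ℤ))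
    push_cast at this
    rw [enorm_mul, this, multN2, if_pos hΦ.1, mul_one, ← ofReal_norm]
    refine ENNReal.ofReal_le_ofReal ?_
    simp only [norm_mul, norm_div, Complex.norm_I, one_mul, Complex.norm_intCast, abs_mul]
    refine mul_le_of_le_one_left (by positivity) (by norm_num)
  have := ((((RelClose.const_mul hc (h q.2.2.1)).mul (h q.2.2.2)).mul
    (h (q.1 - q.2.2.1 - q.2.2.2))).mul (h q.2.1)).mul (h (k - q.1 - q.2.1))
  refine this.mono (le_of_eq ?_) (le_of_eq ?_) <;> ring

theorem RelClose.N2 (hε : ε ≠ 0) (h : ∀ k, RelClose ε (g k) (v k) (w k)) (t : ℝ) (k : ℤ) :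
    RelClose (5 * ε) (majN2 g k) (N2 v t k) (N2 w t k) := by
  have hε' : 5 * ε ≠ 0 := mul_ne_zero (by norm_num) hε
  have := (RelClose.tsum hε' (RelClose.N2term1 h t k)).add
    (RelClose.tsum hε' (RelClose.N2term2 h t k))
  refine this.mono le_rfl (le_of_eq ?_)
  unfold majN2 trilin
  simp only [mul_add, add_mul, ENNReal.tsum_add, Pi.one_apply, one_mul]
  congr 1
  simp_rw [ENNReal.tsum_prod', ← ENNReal.tsum_mul_left, ← ENNReal.tsum_mul_right]

theorem RelClose.N4 (hε : ε ≠ 0) (h : ∀ k, RelClose ε (g k) (v k) (w k)) (n : ℕ) (t : ℝ)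
    (k : ℤ) : RelClose (7 * ε) (majN4 g k) (N4 n v t k) (N4 n w t k) := by
  refine RelClose.tsum (mul_ne_zero (by norm_num) hε) fun p => ?_
  split_ifs with hΦ
  swap; · exact .refl (by simp)
  have hc : ‖((k : ℂ) / ((Phi p.1 p.2 (k - p.1 - p.2) : ℤ) : ℂ)) *
      Complex.exp (Complex.I * (t : ℂ) * ((Phi p.1 p.2 (k - p.1 - p.2) : ℤ) : ℂ))‖ₑ ≤
      multN4 k p := by
    have := enorm_phase t (Phi p.1 p.2 (k - p.1 - p.2) : ℤ)
    rw [enorm_mul, ← Complex.ofReal_intCast (Phi _ _ _), this, multN4, if_pos hΦ.1, mul_one,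
      ← ofReal_norm]
    refine ENNReal.ofReal_le_ofReal (le_of_eq ?_)
    simp
  have := ((RelClose.const_mul hc (RelClose.N2 hε h t p.1)).mul (h p.2)).mul (h (k - p.1 - p.2))
  refine this.mono (le_of_eq ?_) le_rfl
  ring

end Majorants

/-! ### Bounds for the majorants -/

/-- The square of the `H^{1/2}` norm of a nonnegative sequence. -/
noncomputable def energy (g : ℤ → ℝ≥0∞) : ℝ≥0∞ := ∑' k, ENNReal.ofReal (jb k) * g k ^ 2

theorem tsum_sq_le_energy (g : ℤ → ℝ≥0∞) : ∑' k, g k ^ 2 ≤ energy g :=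
  ENNReal.tsum_le_tsum fun k =>
    le_mul_of_one_le_left' (by simpa using one_le_jb k)

theorem tsum_cube_sq_le (g : ℤ → ℝ≥0∞) : ∑' k, (g k ^ 3) ^ 2 ≤ energy g ^ 3 := by
  have hle (k : ℤ) : g k ^ 2 ≤ energy g := (ENNReal.le_tsum k).trans (tsum_sq_le_energy g)
  calc ∑' k, (g k ^ 3) ^ 2 ≤ ∑' k, energy g ^ 2 * g k ^ 2 := by
        refine ENNReal.tsum_le_tsum fun k => ?_
        calc (g k ^ 3) ^ 2 = (g k ^ 2) ^ 2 * g k ^ 2 := by ring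
          _ ≤ _ := by gcongr; exact hle k
    _ ≤ energy g ^ 2 * energy g := by
        rw [ENNReal.tsum_mul_left]; gcongr; exact tsum_sq_le_energy g
    _ = _ := by ring

theorem tsum_trilin_one_sq_le (g : ℤ → ℝ≥0∞) :
    ∑' k, trilin 1 g g g k ^ 2 ≤ triConst * energy g ^ 3 := by
  have := trilinear_sq_le (M := 1) (c := 1) (α := fun x => ENNReal.ofReal (jb x))
    (β := fun x => ENNReal.ofReal (jb x)) (γ := fun x => ENNReal.ofReal (jb x))
    one_le_pairDecay_mul g g g
  simp only [Pi.one_apply, one_mul] at this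
  simp only [trilin, Pi.one_apply, one_mul]
  exact this.trans_eq (by simp only [energy]; ring)

theorem tsum_majN2_sq_le (g : ℤ → ℝ≥0∞) :
    ∑' k, majN2 g k ^ 2 ≤ triConst * (2 * (1 + triConst)) * energy g ^ 5 := by
  have := trilinear_sq_le (M := multN2) (c := fun _ => 1) (α := fun _ => 1)
    (β := fun x => ENNReal.ofReal (jb x)) (γ := fun x => ENNReal.ofReal (jb x))
    multN2_sq_le (fun x => g x ^ 3 + trilin 1 g g g x) g g
  simp only [one_mul] at this
  refine this.trans ?_
  have hu : ∑' x, (g x ^ 3 + trilin 1 g g g x) ^ 2 ≤ 2 * (1 + triConst) * energy g ^ 3 := by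
    calc _ ≤ ∑' x, 2 * ((g x ^ 3) ^ 2 + trilin 1 g g g x ^ 2) :=
          ENNReal.tsum_le_tsum fun x => ENNReal.add_sq_le_two_mul _ _
      _ ≤ 2 * (energy g ^ 3 + triConst * energy g ^ 3) := by
          rw [ENNReal.tsum_mul_left, ENNReal.tsum_add]
          gcongr
          exacts [tsum_cube_sq_le g, tsum_trilin_one_sq_le g]
      _ = _ := by ring
  calc _ ≤ triConst * (2 * (1 + triConst) * energy g ^ 3 * energy g * energy g) := by
        gcongr <;> rfl
    _ = _ := by ring

theorem energy_majN4_le (g : ℤ → ℝ≥0∞) :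
    energy (majN4 g) ≤ triConst ^ 2 * (2 * (1 + triConst)) * energy g ^ 7 := by
  have := trilinear_sq_le (M := multN4) (c := fun x => ENNReal.ofReal (jb x)) (α := fun _ => 1)
    (β := fun x => ENNReal.ofReal (jb x)) (γ := fun x => ENNReal.ofReal (jb x))
    multN4_sq_le (majN2 g) g g
  simp only [one_mul] at this
  refine this.trans ?_
  calc _ ≤ triConst * (triConst * (2 * (1 + triConst)) * energy g ^ 5 * energy g * energy g) := by
        gcongr
        exacts [tsum_majN2_sq_le g, le_rfl, le_rfl]
    _ = _ := by ring

theorem energy_mono {f g : ℤ → ℝ≥0∞} (h : ∀ k, f k ≤ g k) : energy f ≤ energy g :=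
  ENNReal.tsum_le_tsum fun k => by gcongr; exact h k

theorem energy_const_mul (c : ℝ≥0∞) (g : ℤ → ℝ≥0∞) :
    energy (fun k => c * g k) = c ^ 2 * energy g := by
  simp only [energy]
  rw [← ENNReal.tsum_mul_left]
  exact tsum_congr fun k => by ring

theorem energy_add_add_le (f g h : ℤ → ℝ≥0∞) :
    energy (fun k => f k + g k + h k) ≤ 3 * (energy f + energy g + energy h) := by
  simp only [energy]
  rw [← ENNReal.tsum_add, ← ENNReal.tsum_add, ← ENNReal.tsum_mul_left]
  refine ENNReal.tsum_le_tsum fun k => ?_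
  calc _ ≤ ENNReal.ofReal (jb k) * (3 * (f k ^ 2 + g k ^ 2 + h k ^ 2)) := by
        gcongr; exact ENNReal.add_add_sq_le_three_mul _ _ _
    _ = _ := by ring

theorem hnorm_half_sq (f : ℤ → ℂ) : hnorm (1 / 2) f ^ 2 = energy fun k => ‖f k‖ₑ := by
  rw [hnorm, ← ENNReal.rpow_natCast, ← ENNReal.rpow_mul]
  norm_num
  refine tsum_congr fun k => ?_
  rw [ENNReal.ofReal_mul (jb_pos k).le, ENNReal.ofReal_pow (norm_nonneg _), ofReal_norm]

theorem hnorm_half_sub_eq_zero {v w : ℤ → ℂ} (h : hnorm (1 / 2) (fun k => v k - w k) = 0) :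
    v = w := by
  have h0 : energy (fun k => ‖v k - w k‖ₑ) = 0 := by rw [← hnorm_half_sq, h]; simp
  funext k
  have := ENNReal.tsum_eq_zero.1 h0 k
  have hj := jb_pos k
  simpa [hj.not_ge, sub_eq_zero] using this

theorem hnorm_half_sub_sq_le (v w : ℤ → ℂ) :
    hnorm (1 / 2) (fun k => v k - w k) ^ 2 ≤ 3 * (hnorm (1 / 2) v + hnorm (1 / 2) w) ^ 2 := by
  have h := energy_add_add_le (fun k => ‖v k‖ₑ) (fun k => ‖w k‖ₑ) 0
  simp only [← hnorm_half_sq] at h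
  rw [hnorm_half_sq]
  calc energy (fun k => ‖v k - w k‖ₑ)
      ≤ energy (fun k => ‖v k‖ₑ + ‖w k‖ₑ + (0 : ℤ → ℝ≥0∞) k) :=
        energy_mono fun k => by simpa using enorm_sub_le
    _ ≤ 3 * (hnorm (1 / 2) v ^ 2 + hnorm (1 / 2) w ^ 2 + energy 0) := h
    _ ≤ _ := by
        have : energy 0 = 0 := by simp [energy]
        rw [this, add_zero, add_sq]
        gcongr
        exact le_self_add

/-- The constant in the difference estimate for `N4`, squared. -/
noncomputable def diffConst : ℝ≥0∞ := 49 * (triConst ^ 2 * (2 * (1 + triConst))) * 9 ^ 7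

theorem diffConst_ne_top : diffConst ≠ ⊤ := by
  have := triConst_ne_top
  unfold diffConst
  finiteness

theorem hnorm_N4_sub_sq_le (n : ℕ) (t : ℝ) (v w : ℤ → ℂ) (hv : hnorm (1 / 2) v < ⊤)
    (hw : hnorm (1 / 2) w < ⊤) :
    hnorm (1 / 2) (fun k => N4 n v t k - N4 n w t k) ^ 2 ≤ diffConst *
      ((hnorm (1 / 2) v + hnorm (1 / 2) w) ^ 6 * hnorm (1 / 2) (fun k => v k - w k)) ^ 2 := by
  by_cases hD0 : hnorm (1 / 2) (fun k => v k - w k) = 0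
  · rw [hnorm_half_sub_eq_zero hD0, hnorm_half_sq]
    simp [energy]
  have hDS := hnorm_half_sub_sq_le v w
  set V := hnorm (1 / 2) v with hV
  set W := hnorm (1 / 2) w with hW
  set D := hnorm (1 / 2) (fun k => v k - w k) with hD
  set S := V + W with hS
  have hStop : S ≠ ⊤ := (ENNReal.add_lt_top.2 ⟨hv, hw⟩).ne
  have hDtop : D ≠ ⊤ := fun h => by
    rw [h] at hDS
    exact (by finiteness : 3 * S ^ 2 ≠ ⊤) (top_le_iff.1 (by simpa using hDS))
  have hS0 : S ≠ 0 := fun h => hD0 (by simpa [h] using hDS)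
  set g : ℤ → ℝ≥0∞ := fun k => ‖v k‖ₑ + ‖w k‖ₑ + S / D * ‖v k - w k‖ₑ with hg
  have hε : D / S ≠ 0 := ENNReal.div_ne_zero.2 ⟨hD0, hStop⟩
  have hclose (k : ℤ) : RelClose (D / S) (g k) (v k) (w k) := by
    refine ⟨le_add_right le_self_add, le_add_right le_add_self, ?_⟩
    calc ‖v k - w k‖ₑ = D / S * (S / D * ‖v k - w k‖ₑ) := by
          rw [← mul_assoc, ← ENNReal.inv_div (.inl hDtop) (.inl hD0), ENNReal.inv_mul_cancel
            (ENNReal.div_ne_zero.2 ⟨hS0, hDtop⟩) (ENNReal.div_ne_top hStop hD0), one_mul]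
      _ ≤ _ := by gcongr; exact le_add_self
  have hgE : energy g ≤ 9 * S ^ 2 := by
    refine (energy_add_add_le _ _ _).trans ?_
    rw [energy_const_mul, ← hnorm_half_sq, ← hnorm_half_sq, ← hnorm_half_sq, ← hV, ← hW, ← hD,
      ← mul_pow, ENNReal.div_mul_cancel hD0 hDtop]
    calc 3 * (V ^ 2 + W ^ 2 + S ^ 2) ≤ 3 * (S ^ 2 + S ^ 2 + S ^ 2) := by
          gcongr
          exacts [le_self_add, le_add_self]
      _ = _ := by ring
  calc hnorm (1 / 2) (fun k => N4 n v t k - N4 n w t k) ^ 2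
      ≤ energy (fun k => 7 * (D / S) * majN4 g k) := by
        rw [hnorm_half_sq]
        exact energy_mono fun k => (RelClose.N4 hε hclose n t k).sub
    _ ≤ (7 * (D / S)) ^ 2 * (triConst ^ 2 * (2 * (1 + triConst)) * (9 * S ^ 2) ^ 7) := by
        rw [energy_const_mul]
        gcongr
        exact (energy_majN4_le g).trans (by gcongr)
    _ = diffConst * (S ^ 6 * (D / S * S)) ^ 2 := by unfold diffConst; ring
    _ = _ := by rw [ENNReal.div_mul_cancel hS0 hStop]

theorem N4_zero (n : ℕ) (t : ℝ) (k : ℤ) : N4 n (fun _ => 0) t k = 0 := by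
  simp [N4]

/-- Septilinear estimates for `N₄` at the endpoint regularity `s = 1/2`. -/
theorem N4_estimates :
    ∃ C > (0 : ℝ), ∀ n : ℕ, ∀ t : ℝ, ∀ v w : ℤ → ℂ,
      hnorm (1 / 2) v < ⊤ → hnorm (1 / 2) w < ⊤ →
      hnorm (1 / 2) (fun k => N4 n v t k) ≤ ENNReal.ofReal C * hnorm (1 / 2) v ^ 7 ∧
      hnorm (1 / 2) (fun k => N4 n v t k - N4 n w t k) ≤
        ENNReal.ofReal C * (hnorm (1 / 2) v + hnorm (1 / 2) w) ^ 6 *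
          hnorm (1 / 2) (fun k => v k - w k) := by
  have hdiff : ∃ C > (0 : ℝ), ∀ n : ℕ, ∀ t : ℝ, ∀ v w : ℤ → ℂ,
      hnorm (1 / 2) v < ⊤ → hnorm (1 / 2) w < ⊤ →
      hnorm (1 / 2) (fun k => N4 n v t k - N4 n w t k) ≤
        ENNReal.ofReal C * (hnorm (1 / 2) v + hnorm (1 / 2) w) ^ 6 *
          hnorm (1 / 2) (fun k => v k - w k) := by
    refine ⟨diffConst.toReal + 1, by positivity, fun n t v w hv hw => ?_⟩
    rw [← ENNReal.pow_le_pow_left_iff (n := 2) two_ne_zero, mul_assoc, mul_pow]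
    refine (hnorm_N4_sub_sq_le n t v w hv hw).trans ?_
    gcongr
    rw [ENNReal.ofReal_add (by positivity) zero_le_one, ENNReal.ofReal_toReal diffConst_ne_top,
      ENNReal.ofReal_one]
    calc diffConst ≤ diffConst + 1 := le_self_add
      _ ≤ _ := le_self_pow₀ le_add_self two_ne_zero
  obtain ⟨C, hC, h⟩ := hdiff
  refine ⟨C, hC, fun n t v w hv hw => ⟨?_, h n t v w hv hw⟩⟩
  have h0 : hnorm (1 / 2) (fun _ => 0) = 0 := by simp [hnorm]
  have := h n t v (fun _ => 0) hv (h0.trans_lt ENNReal.zero_lt_top)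
  simp only [N4_zero, sub_zero, h0, add_zero] at this
  rwa [mul_assoc, ← pow_succ] at this
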